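/- arXiv:2601.10529 — 11 statements merged into one kernel-verified Lean document; each statement's English description precedes it below -/
import Mathlib

section
/- Let Q be a nonzero real polynomial. Then, counting roots with multiplicity: pos(Q) ≤ pos(Q') + 1 and neg(Q) ≤ neg(Q') + 1. Moreover, if additionally Q'(0) ≠ 0, then pos(Q) + neg(Q) ≤ pos(Q') + neg(Q') + 1. -/
open Polynomial

/-- The number of roots of `Q` in `(0, ∞)`, counted with multiplicity. -/
noncomputable def posRoots (Q : Polynomial ℝ) : ℕ :=
  (Q.roots.filter fun x => 0 < x).card

/-- The number of roots of `Q` in `(−∞, 0)`, counted with multiplicity. -/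
noncomputable def negRoots (Q : Polynomial ℝ) : ℕ :=
  (Q.roots.filter fun x => x < 0).card

/-- Rolle's theorem on an order-connected set: the distinct roots of `p` in the set outnumber the
roots of its derivative in the set that are not roots of `p` by at most one. -/
theorem card_toFinset_filter_roots_le_derivative_sdiff (p : ℝ[X]) (P : ℝ → Prop) [DecidablePred P]
    (hP : {x | P x}.OrdConnected) :
    (p.roots.filter P).toFinset.card ≤
      ((p.derivative.roots.filter P).toFinset \ (p.roots.filter P).toFinset).card + 1 := by
  rcases eq_or_ne (derivative p) 0 with hp' | hp'
  · rw [eq_C_of_derivative_eq_zero hp']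
    simp
  have hp : p ≠ 0 := ne_of_apply_ne derivative (by rwa [derivative_zero])
  refine Finset.card_le_sdiff_of_interleaved fun x hx y hy hxy _ => ?_
  rw [Multiset.mem_toFinset, Multiset.mem_filter, mem_roots hp] at hx hy
  obtain ⟨z, hz, hz'⟩ := exists_deriv_eq_zero hxy p.continuousOn (hx.1.trans hy.1.symm)
  refine ⟨z, ?_, hz⟩
  rw [Multiset.mem_toFinset, Multiset.mem_filter, mem_roots hp', IsRoot, ← p.deriv]
  exact ⟨hz', hP.out hx.2 hy.2 (Set.Ioo_subset_Icc_self hz)⟩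

/-- The number of roots of a real polynomial in an order-connected set, counted with
multiplicities, is at most that of its derivative plus one. -/
theorem card_filter_roots_le_derivative (p : ℝ[X]) (P : ℝ → Prop) [DecidablePred P]
    (hP : {x | P x}.OrdConnected) :
    (p.roots.filter P).card ≤ (p.derivative.roots.filter P).card + 1 := by
  set A := p.roots.filter P with hA
  set B := p.derivative.roots.filter P with hB
  have hcount : ∀ x ∈ A.toFinset, A.count x ≤ B.count x + 1 := by
    intro x hx
    have hPx : P x := (Multiset.mem_filter.1 (Multiset.mem_toFinset.1 hx)).2
    rw [hA, hB, Multiset.count_filter_of_pos hPx, Multiset.count_filter_of_pos hPx,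
      count_roots, count_roots]
    exact Nat.sub_le_iff_le_add.1 (rootMultiplicity_sub_one_le_derivative_rootMultiplicity p x)
  have hsdiff : (B.toFinset \ A.toFinset).card ≤ ∑ x ∈ B.toFinset \ A.toFinset, B.count x := by
    rw [Finset.card_eq_sum_ones]
    exact Finset.sum_le_sum fun x hx =>
      Multiset.one_le_count_iff_mem.2 (Multiset.mem_toFinset.1 (Finset.mem_sdiff.1 hx).1)
  calc
    A.card = ∑ x ∈ A.toFinset, A.count x := (Multiset.toFinset_sum_count_eq _).symm
    _ ≤ ∑ x ∈ A.toFinset, (B.count x + 1) := Finset.sum_le_sum hcount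
    _ = ∑ x ∈ A.toFinset, B.count x + A.toFinset.card := by
      rw [Finset.sum_add_distrib, Finset.card_eq_sum_ones]
    _ ≤ ∑ x ∈ A.toFinset, B.count x + (∑ x ∈ B.toFinset \ A.toFinset, B.count x + 1) := by
      grw [card_toFinset_filter_roots_le_derivative_sdiff p P hP, hsdiff]
    _ = B.card + 1 := by
      rw [← add_assoc, ← Finset.sum_union Finset.disjoint_sdiff,
        Finset.union_sdiff_self_eq_union,
        Multiset.sum_count_eq_card fun x hx =>
          Finset.mem_union_right _ (Multiset.mem_toFinset.2 hx)]

/-- The positive roots, the negative roots and the root `0` together make up all roots. -/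
theorem posRoots_add_negRoots_add_count_zero (p : ℝ[X]) :
    posRoots p + negRoots p + p.roots.count 0 = p.roots.card := by
  unfold posRoots negRoots
  induction p.roots using Multiset.induction_on with
  | empty => simp
  | cons a s ih =>
    rcases lt_trichotomy a 0 with h | rfl | h
    · simp [h, h.not_gt, h.ne']
      omega
    · simp
      omega
    · simp [h, h.not_gt, h.ne]
      omega

/-- Rolle-type restrictions: `pos(Q) ≤ pos(Q') + 1`, `neg(Q) ≤ neg(Q') + 1`, and if
moreover `Q'(0) ≠ 0` then `pos(Q) + neg(Q) ≤ pos(Q') + neg(Q') + 1`. -/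
theorem stmt_2 (Q : Polynomial ℝ) (hQ : Q ≠ 0) :
    posRoots Q ≤ posRoots (derivative Q) + 1 ∧
    negRoots Q ≤ negRoots (derivative Q) + 1 ∧
    ((derivative Q).eval 0 ≠ 0 →
      posRoots Q + negRoots Q ≤ posRoots (derivative Q) + negRoots (derivative Q) + 1) := by
  refine ⟨card_filter_roots_le_derivative Q _ Set.ordConnected_Ioi,
    card_filter_roots_le_derivative Q _ Set.ordConnected_Iio, fun h0 => ?_⟩
  have hcount : (derivative Q).roots.count 0 = 0 :=
    Multiset.count_eq_zero.2 fun h => h0 (isRoot_of_mem_roots h)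
  have hcard := card_roots_le_derivative Q
  have hQ_split := posRoots_add_negRoots_add_count_zero Q
  have hQ'_split := posRoots_add_negRoots_add_count_zero (derivative Q)
  omega
end

section
/- The set {(a, f, g) ∈ ℝ³ : 0 < a, a < f, 0 < g, g < min(f²/4, a f/4)}, equipped with the subspace topology of ℝ³, is contractible. -/
/-- The convex model: the sector `{0 < a < f}` times the interval `(0, 1/4)`. -/
def sectorPrism : Set (ℝ × ℝ × ℝ) :=
  {q | 0 < q.1 ∧ q.1 < q.2.1 ∧ 0 < q.2.2 ∧ q.2.2 < 1 / 4}

theorem convex_sectorPrism : Convex ℝ sectorPrism := by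
  rintro x ⟨hx₁, hx₂, hx₃, hx₄⟩ y ⟨hy₁, hy₂, hy₃, hy₄⟩ s t hs ht hst
  have hlt : ∀ {u v u' v' : ℝ}, u < v → u' < v' → s * u + t * u' < s * v + t * v' := by
    intro u v u' v' h h'
    rcases hs.eq_or_lt with rfl | hs
    · obtain rfl : t = 1 := by linarith
      simpa using h'
    · exact add_lt_add_of_lt_of_le (mul_lt_mul_of_pos_left h hs)
        (mul_le_mul_of_nonneg_left h'.le ht)
  refine ⟨?_, ?_, ?_, ?_⟩ <;> simp only [Prod.fst_add, Prod.snd_add, Prod.smul_fst,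
    Prod.smul_snd, smul_eq_mul]
  · simpa using hlt hx₁ hy₁
  · exact hlt hx₂ hy₂
  · simpa using hlt hx₃ hy₃
  · have h := hlt hx₄ hy₄
    rwa [← add_mul, hst, one_mul] at h

theorem nonempty_sectorPrism : sectorPrism.Nonempty :=
  ⟨(1, 2, 1 / 8), by norm_num [sectorPrism]⟩

/-- Rescaling every fibre `0 < g < min (f² / 4) (a f / 4)` by `1 / (a f)` identifies the total
space with `sectorPrism`. -/
noncomputable def fibreRescaling :
    {p : ℝ × ℝ × ℝ // 0 < p.1 ∧ p.1 < p.2.1 ∧ 0 < p.2.2 ∧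
      p.2.2 < min (p.2.1 ^ 2 / 4) (p.1 * p.2.1 / 4)} ≃ₜ sectorPrism where
  toFun p := ⟨(p.1.1, p.1.2.1, p.1.2.2 / (p.1.1 * p.1.2.1)), by
    obtain ⟨⟨a, f, g⟩, ha, hf, hg, hm⟩ := p
    have haf : 0 < a * f := mul_pos ha (ha.trans hf)
    refine ⟨ha, hf, div_pos hg haf, ?_⟩
    rw [div_lt_iff₀ haf]
    have : g < a * f / 4 := (lt_min_iff.1 hm).2
    change g < 1 / 4 * (a * f)
    linarith⟩
  invFun q := ⟨(q.1.1, q.1.2.1, q.1.2.2 * (q.1.1 * q.1.2.1)), by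
    obtain ⟨⟨a, f, h⟩, ha, hf, hh, hm⟩ := q
    dsimp only at ha hf hh hm ⊢
    have hf₀ : 0 < f := ha.trans hf
    have haf : 0 < a * f := mul_pos ha hf₀
    have hlt := mul_lt_mul_of_pos_right hm haf
    refine ⟨ha, hf, mul_pos hh haf, lt_min ?_ ?_⟩
    · have := mul_lt_mul_of_pos_right hf hf₀
      nlinarith
    · linarith⟩
  left_inv := by
    rintro ⟨⟨a, f, g⟩, ha, hf, hg, hm⟩
    have haf : a * f ≠ 0 := (mul_pos ha (ha.trans hf)).ne'
    simp [div_mul_cancel₀ g haf]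
  right_inv := by
    rintro ⟨⟨a, f, h⟩, ha, hf, hh, hm⟩
    have haf : a * f ≠ 0 := (mul_pos ha (ha.trans hf)).ne'
    simp [mul_div_cancel_right₀ h haf]
  continuous_toFun := by
    refine Continuous.subtype_mk ?_ _
    refine Continuous.prodMk (by fun_prop) (Continuous.prodMk (by fun_prop) ?_)
    exact Continuous.div (by fun_prop) (by fun_prop)
      fun p => (mul_pos p.2.1 (p.2.1.trans p.2.2.1)).ne'
  continuous_invFun := by
    refine Continuous.subtype_mk ?_ _
    fun_prop

/-- The set `{(a,f,g) : 0 < a, a < f, 0 < g, g < min(f²/4, af/4)}` (the set `R₀,₁`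
of the paper), with the subspace topology of `ℝ³`, is contractible. -/
theorem stmt_5 :
    ContractibleSpace {p : ℝ × ℝ × ℝ //
      0 < p.1 ∧ p.1 < p.2.1 ∧ 0 < p.2.2 ∧
        p.2.2 < min (p.2.1 ^ 2 / 4) (p.1 * p.2.1 / 4)} := by
  have : ContractibleSpace sectorPrism :=
    convex_sectorPrism.contractibleSpace nonempty_sectorPrism
  exact fibreRescaling.contractibleSpace
end

section
/- Let a, f, b be real numbers. Then the following are equivalent: (i) f > 0, a² < 4b, and the expansion (x − f/2)²(x² + a x + b) = x⁴ + (a − f)x³ + (f²/4 − a f + b)x² + (f² a/4 − f b)x + f² b/4 has coefficient signs a − f < 0, f²/4 − a f + b < 0, f² a/4 − f b < 0, f² b/4 > 0 (sign pattern (+,−,−,−,+)); (ii) 0 < f, f/3 < a < f, and a f/4 < b < a f − f²/4. -/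
/-- For real `a, f, b`: the quartic `(x − f/2)²(x² + ax + b)` with `f > 0` and
`a² < 4b` has coefficient signs `(+,−,−,−,+)` if and only if `0 < f`,
`f/3 < a < f` and `af/4 < b < af − f²/4`. -/
theorem stmt_6 (a f b : ℝ) :
    (0 < f ∧ a ^ 2 < 4 * b ∧
      (∀ x : ℝ, (x - f / 2) ^ 2 * (x ^ 2 + a * x + b) =
        x ^ 4 + (a - f) * x ^ 3 + (f ^ 2 / 4 - a * f + b) * x ^ 2 +
          (f ^ 2 * a / 4 - f * b) * x + f ^ 2 * b / 4) ∧
      a - f < 0 ∧ f ^ 2 / 4 - a * f + b < 0 ∧ f ^ 2 * a / 4 - f * b < 0 ∧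
        0 < f ^ 2 * b / 4) ↔
    (0 < f ∧ f / 3 < a ∧ a < f ∧ a * f / 4 < b ∧ b < a * f - f ^ 2 / 4) := by
  constructor
  · rintro ⟨hf, -, -, h3, h2, h1, -⟩
    have hb : a * f / 4 < b := by
      refine lt_of_mul_lt_mul_left ?_ hf.le
      linarith
    have ha : f / 3 < a := by
      refine lt_of_mul_lt_mul_left ?_ hf.le
      linarith
    exact ⟨hf, ha, by linarith, hb, by linarith⟩
  · rintro ⟨hf, ha, haf, hb, hb'⟩
    have ha0 : 0 < a := by linarith
    have hsq : a * a < a * f := mul_lt_mul_of_pos_left haf ha0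
    have hb0 : 0 < b := lt_trans (by positivity) hb
    have hfb : f * (a * f / 4) < f * b := mul_lt_mul_of_pos_left hb hf
    exact ⟨hf, by linarith, fun x => by ring, by linarith, by linarith, by linarith,
      by positivity⟩
end

section
/- The set {(a, f, b) ∈ ℝ³ : 0 < f, f/3 < a, a < f, a f/4 < b, b < a f − f²/4}, equipped with the subspace topology of ℝ³, is contractible. -/
/-- The convex set `{(u,f,v) : 0 < f, 1/3 < u < 1, u/4 < v < u − 1/4}`. -/
def normalizedSet : Set (ℝ × ℝ × ℝ) :=
  {q | 0 < q.2.1 ∧ 1 / 3 < q.1 ∧ q.1 < 1 ∧ q.1 / 4 < q.2.2 ∧ q.2.2 < q.1 - 1 / 4}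

theorem convex_normalizedSet : Convex ℝ normalizedSet := by
  rw [convex_iff_forall_pos]
  rintro ⟨u, f, v⟩ ⟨h1, h2, h3, h4, h5⟩ ⟨u', f', v'⟩ ⟨k1, k2, k3, k4, k5⟩ s t hs ht hst
  obtain rfl : t = 1 - s := by linarith
  simp only [normalizedSet, Set.mem_ofPred_eq, Prod.smul_mk, Prod.mk_add_mk, smul_eq_mul]
    at h1 h2 h3 h4 h5 k1 k2 k3 k4 k5 ⊢
  refine ⟨by positivity, ?_, ?_, ?_, ?_⟩ <;> nlinarith

theorem nonempty_normalizedSet : normalizedSet.Nonempty :=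
  ⟨(2 / 3, 1, 1 / 4), by norm_num [normalizedSet]⟩

/-- The weighted rescaling `(a, f, b) ↦ (a / f, f, b / f²)`. -/
noncomputable def rescaleHomeomorph :
    {p : ℝ × ℝ × ℝ //
      0 < p.2.1 ∧ p.2.1 / 3 < p.1 ∧ p.1 < p.2.1 ∧
        p.1 * p.2.1 / 4 < p.2.2 ∧ p.2.2 < p.1 * p.2.1 - p.2.1 ^ 2 / 4} ≃ₜ normalizedSet where
  toFun p := ⟨(p.1.1 / p.1.2.1, p.1.2.1, p.1.2.2 / p.1.2.1 ^ 2), by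
    obtain ⟨⟨a, f, b⟩, hf, h1, h2, h3, h4⟩ := p
    dsimp only at hf h1 h2 h3 h4
    have e : a / f * f ^ 2 = a * f := by field_simp
    refine ⟨hf, ?_, ?_, ?_, ?_⟩ <;> dsimp only
    · rw [lt_div_iff₀ hf]; linarith
    · rwa [div_lt_one hf]
    · rw [lt_div_iff₀ (by positivity)]; linarith
    · rw [div_lt_iff₀ (by positivity)]; linarith⟩
  invFun q := ⟨(q.1.1 * q.1.2.1, q.1.2.1, q.1.2.2 * q.1.2.1 ^ 2), by
    obtain ⟨⟨u, f, v⟩, hf, h1, h2, h3, h4⟩ := q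
    dsimp only at hf h1 h2 h3 h4
    have hf2 : 0 < f ^ 2 := by positivity
    refine ⟨hf, ?_, ?_, ?_, ?_⟩ <;> dsimp only <;> nlinarith⟩
  left_inv p := by
    obtain ⟨⟨a, f, b⟩, hf, -⟩ := p
    have hf' : f ≠ 0 := ne_of_gt hf
    simp [hf']
  right_inv q := by
    obtain ⟨⟨u, f, v⟩, hf, -⟩ := q
    have hf' : f ≠ 0 := ne_of_gt hf
    simp [hf']
  continuous_toFun := by
    refine Continuous.subtype_mk (.prodMk ?_ (.prodMk (by fun_prop) ?_)) _
    · exact Continuous.div (by fun_prop) (by fun_prop) fun p => p.2.1.ne'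
    · exact Continuous.div (by fun_prop) (by fun_prop) fun p => pow_ne_zero 2 p.2.1.ne'
  continuous_invFun := by fun_prop

/-- The set `{(a,f,b) : 0 < f, f/3 < a < f, af/4 < b < af − f²/4}` (the set `R₁,₂`
of the paper), with the subspace topology of `ℝ³`, is contractible. -/
theorem stmt_7 :
    ContractibleSpace {p : ℝ × ℝ × ℝ //
      0 < p.2.1 ∧ p.2.1 / 3 < p.1 ∧ p.1 < p.2.1 ∧
        p.1 * p.2.1 / 4 < p.2.2 ∧ p.2.2 < p.1 * p.2.1 - p.2.1 ^ 2 / 4} :=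
  have := convex_normalizedSet.contractibleSpace nonempty_normalizedSet
  rescaleHomeomorph.contractibleSpace
end

section
/- Every monic real polynomial P = x⁴ + b₃x³ + b₂x² + b₁x + b₀ with b₃ < 0, b₂ < 0, b₁ > 0, b₀ > 0 can be written in the form P = (x² + a x + b)(x² − f x + g) with real numbers a > 0, b > 0, f > 0, g > 0. -/
/-- Every monic real quartic with sign pattern `(+,−,−,+,+)` factors as
`(x² + ax + b)(x² − fx + g)` with `a, b, f, g > 0`. -/
theorem stmt_8 (b₃ b₂ b₁ b₀ : ℝ) (h₃ : b₃ < 0) (h₂ : b₂ < 0) (h₁ : 0 < b₁)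
    (h₀ : 0 < b₀) :
    ∃ a b f g : ℝ, 0 < a ∧ 0 < b ∧ 0 < f ∧ 0 < g ∧
      ∀ x : ℝ, x ^ 4 + b₃ * x ^ 3 + b₂ * x ^ 2 + b₁ * x + b₀ =
        (x ^ 2 + a * x + b) * (x ^ 2 - f * x + g) := by
  -- Comparing coefficients forces `f = a - b₃` and `b + g = S a`; the remaining unknown `a`
  -- is found by two applications of the intermediate value theorem.
  let S : ℝ → ℝ := fun a => b₂ + a * (a - b₃)
  let N : ℝ := 1 - b₂ + b₁ + 4 * b₀
  have hN : 1 ≤ N := by simp only [N]; linarith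
  have hNN : N ≤ N * N := by nlinarith
  have hSN : 1 + 4 * b₀ + b₁ ≤ S N := by
    have : 0 ≤ N * (-b₃) := mul_nonneg (by linarith) (by linarith)
    have hNdef : N = 1 - b₂ + b₁ + 4 * b₀ := rfl
    simp only [S]
    linarith
  obtain ⟨a₀, ⟨ha₀, ha₀N⟩, hSa₀⟩ : ∃ a ∈ Set.Icc 0 N, a * S a = b₁ := by
    have hc : ContinuousOn (fun a => a * S a) (Set.Icc 0 N) := by
      simp only [S]; fun_prop
    refine intermediate_value_Icc (by linarith) hc ⟨by simpa using h₁.le, ?_⟩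
    change b₁ ≤ N * S N
    nlinarith
  have ha₀pos : 0 < a₀ := by
    rcases ha₀.eq_or_lt with h | h
    · rw [← h, zero_mul] at hSa₀; linarith
    · exact h
  have hSa₀pos : 0 < S a₀ := pos_of_mul_pos_right (hSa₀ ▸ h₁) ha₀
  obtain ⟨a, ⟨haa₀, -⟩, ha⟩ : ∃ a ∈ Set.Icc a₀ N,
      (b₁ + (a - b₃) * S a) * (a * S a - b₁) - b₀ * (a + (a - b₃)) ^ 2 = 0 := by
    have hc : ContinuousOn (fun a => (b₁ + (a - b₃) * S a) * (a * S a - b₁)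
        - b₀ * (a + (a - b₃)) ^ 2) (Set.Icc a₀ N) := by
      simp only [S]; fun_prop
    refine intermediate_value_Icc ha₀N hc ⟨?_, ?_⟩
    · change (b₁ + (a₀ - b₃) * S a₀) * (a₀ * S a₀ - b₁) - b₀ * (a₀ + (a₀ - b₃)) ^ 2 ≤ 0
      rw [hSa₀, sub_self, mul_zero, zero_sub]
      exact neg_nonpos.2 (by positivity)
    · change 0 ≤ (b₁ + (N - b₃) * S N) * (N * S N - b₁) - b₀ * (N + (N - b₃)) ^ 2
      have hf : N ≤ N - b₃ := by linarith
      have hleft : N - b₃ ≤ b₁ + (N - b₃) * S N := by nlinarith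
      have hright : (N - b₃) * (1 + 4 * b₀) ≤ N * S N - b₁ := by
        have hS : N * S N - b₁ = (N - b₃) * (N * N) + b₂ * N - b₁ := by simp only [S]; ring
        have h1 : (N - b₃) * N ≤ (N - b₃) * (N * N) :=
          mul_le_mul_of_nonneg_left hNN (by linarith)
        have h2 : (N - b₃) * N = (N - b₃) * (1 + 4 * b₀) + (N - b₃) * (-b₂) + (N - b₃) * b₁ := by
          rw [show (N - b₃) * N = (N - b₃) * (1 - b₂ + b₁ + 4 * b₀) from rfl]
          ring
        have h3 : N * (-b₂) ≤ (N - b₃) * (-b₂) := mul_le_mul_of_nonneg_right hf (by linarith)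
        have h4 : 1 * b₁ ≤ (N - b₃) * b₁ := mul_le_mul_of_nonneg_right (by linarith) h₁.le
        linarith
      have hprod : (N - b₃) * ((N - b₃) * (1 + 4 * b₀)) ≤
          (b₁ + (N - b₃) * S N) * (N * S N - b₁) :=
        mul_le_mul hleft hright (mul_nonneg (by linarith) (by linarith)) (by nlinarith)
      have hsq : b₀ * (N + (N - b₃)) ^ 2 ≤ b₀ * (2 * (N - b₃)) ^ 2 :=
        mul_le_mul_of_nonneg_left (pow_le_pow_left₀ (by linarith) (by linarith) 2) h₀.le
      nlinarith [sq_nonneg (N - b₃)]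
  have hapos : 0 < a := ha₀pos.trans_le haa₀
  have hf : 0 < a - b₃ := by linarith
  have hS : S a₀ ≤ S a := by
    have : a₀ * (a₀ - b₃) ≤ a * (a - b₃) :=
      mul_le_mul haa₀ (by linarith) (by linarith) hapos.le
    simp only [S]
    linarith
  have hSpos : 0 < S a := hSa₀pos.trans_le hS
  have hd : 0 < a + (a - b₃) := by linarith
  have hg : 0 < b₁ + (a - b₃) * S a := by positivity
  have hb : 0 < a * S a - b₁ := by
    have : 0 < b₀ * (a + (a - b₃)) ^ 2 := by positivity
    exact pos_of_mul_pos_right (by linarith) hg.le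
  refine ⟨a, (a * S a - b₁) / (a + (a - b₃)), a - b₃, (b₁ + (a - b₃) * S a) / (a + (a - b₃)),
    hapos, div_pos hb hd, hf, div_pos hg hd, fun x => ?_⟩
  have hmul : (a * S a - b₁) / (a + (a - b₃)) * ((b₁ + (a - b₃) * S a) / (a + (a - b₃))) = b₀ := by
    rw [div_mul_div_comm, div_eq_iff (by positivity)]
    linarith
  have hadd : (a * S a - b₁) / (a + (a - b₃)) + (b₁ + (a - b₃) * S a) / (a + (a - b₃)) =
      b₂ + a * (a - b₃) := by
    rw [← add_div, div_eq_iff hd.ne']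
    simp only [S]
    ring
  have hcross : a * ((b₁ + (a - b₃) * S a) / (a + (a - b₃))) -
      (a - b₃) * ((a * S a - b₁) / (a + (a - b₃))) = b₁ := by
    rw [← mul_div_assoc, ← mul_div_assoc, ← sub_div, div_eq_iff hd.ne']
    ring
  linear_combination -hmul - x ^ 2 * hadd - x * hcross
end

section
/- The set {(a, f, g) ∈ ℝ³ : 0 < a, a < f, a f/4 < g, g < a f − a²/4}, equipped with the subspace topology of ℝ³, is contractible. -/
/-- The convex region obtained from `L₋` by the substitution `g = a * h`. -/
def rescaledRegion : Set (ℝ × ℝ × ℝ) :=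
  {p | 0 < p.1 ∧ p.1 < p.2.1 ∧ p.2.1 / 4 < p.2.2 ∧ p.2.2 < p.2.1 - p.1 / 4}

lemma convex_rescaledRegion : Convex ℝ rescaledRegion := by
  rw [convex_iff_forall_pos]
  rintro ⟨a, f, h⟩ ⟨h₁, h₂, h₃, h₄⟩ ⟨a', f', h'⟩ ⟨k₁, k₂, k₃, k₄⟩ s t hs ht -
  simp only [rescaledRegion, Set.mem_ofPred_eq, Prod.smul_mk, Prod.mk_add_mk, smul_eq_mul] at *
  refine ⟨by positivity, ?_, ?_, ?_⟩
  · linarith [mul_lt_mul_of_pos_left h₂ hs, mul_lt_mul_of_pos_left k₂ ht]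
  · linarith [mul_lt_mul_of_pos_left h₃ hs, mul_lt_mul_of_pos_left k₃ ht]
  · linarith [mul_lt_mul_of_pos_left h₄ hs, mul_lt_mul_of_pos_left k₄ ht]

lemma rescaledRegion_nonempty : rescaledRegion.Nonempty :=
  ⟨(1, 2, 1), by norm_num [rescaledRegion]⟩

/-- The homeomorphism `(a, f, g) ↦ (a, f, g / a)` from `L₋` onto the rescaled region. -/
noncomputable def homeomorphRescaledRegion :
    {p : ℝ × ℝ × ℝ //
      0 < p.1 ∧ p.1 < p.2.1 ∧ p.1 * p.2.1 / 4 < p.2.2 ∧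
        p.2.2 < p.1 * p.2.1 - p.1 ^ 2 / 4} ≃ₜ rescaledRegion where
  toFun p := ⟨(p.1.1, p.1.2.1, p.1.2.2 / p.1.1), by
    obtain ⟨⟨a, f, g⟩, h₁, h₂, h₃, h₄⟩ := p
    dsimp only at *
    refine ⟨h₁, h₂, ?_, ?_⟩
    · rw [lt_div_iff₀ h₁]
      linarith
    · rw [div_lt_iff₀ h₁]
      linarith⟩
  invFun p := ⟨(p.1.1, p.1.2.1, p.1.1 * p.1.2.2), by
    obtain ⟨⟨a, f, h⟩, h₁, h₂, h₃, h₄⟩ := p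
    dsimp only at *
    refine ⟨h₁, h₂, ?_, ?_⟩
    · linarith [mul_lt_mul_of_pos_left h₃ h₁]
    · linarith [mul_lt_mul_of_pos_left h₄ h₁]⟩
  left_inv p := by
    ext <;> simp [mul_div_cancel₀ _ p.2.1.ne']
  right_inv p := by
    ext <;> simp [mul_div_cancel_left₀ _ p.2.1.ne']
  continuous_toFun := by
    have h : Continuous fun p : {p : ℝ × ℝ × ℝ //
        0 < p.1 ∧ p.1 < p.2.1 ∧ p.1 * p.2.1 / 4 < p.2.2 ∧
          p.2.2 < p.1 * p.2.1 - p.1 ^ 2 / 4} => p.1.2.2 / p.1.1 :=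
      Continuous.div (by fun_prop) (by fun_prop) fun p => p.2.1.ne'
    fun_prop
  continuous_invFun := by fun_prop

/-- The set `{(a,f,g) : 0 < a, a < f, af/4 < g < af − a²/4}` (the set `L₋` of the
paper), with the subspace topology of `ℝ³`, is contractible. -/
theorem stmt_11 :
    ContractibleSpace {p : ℝ × ℝ × ℝ //
      0 < p.1 ∧ p.1 < p.2.1 ∧ p.1 * p.2.1 / 4 < p.2.2 ∧
        p.2.2 < p.1 * p.2.1 - p.1 ^ 2 / 4} := by
  have := convex_rescaledRegion.contractibleSpace rescaledRegion_nonempty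
  exact homeomorphRescaledRegion.contractibleSpace
end

section
/- Let a, f, b be real numbers with f > 0, and expand (x² + a x + b)(x − f/2)² = x⁴ + (a − f)x³ + (b − a f + f²/4)x² + (f² a/4 − f b)x + f² b/4. Then the coefficients satisfy a − f < 0, b − a f + f²/4 < 0, f² a/4 − f b > 0 and f² b/4 > 0 (sign pattern (+,−,−,+,+)) if and only if f/4 < a < f and 0 < b < min(a f − f²/4, a f/4). -/
/-- For `f > 0`, the expansion of `(x² + ax + b)(x − f/2)²` has coefficient signs
`(+,−,−,+,+)` if and only if `f/4 < a < f` and `0 < b < min(af − f²/4, af/4)`. -/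
theorem stmt_12 (a f b : ℝ) (hf : 0 < f) :
    (∀ x : ℝ, (x ^ 2 + a * x + b) * (x - f / 2) ^ 2 =
      x ^ 4 + (a - f) * x ^ 3 + (b - a * f + f ^ 2 / 4) * x ^ 2 +
        (f ^ 2 * a / 4 - f * b) * x + f ^ 2 * b / 4) ∧
    ((a - f < 0 ∧ b - a * f + f ^ 2 / 4 < 0 ∧ 0 < f ^ 2 * a / 4 - f * b ∧
        0 < f ^ 2 * b / 4) ↔
      (f / 4 < a ∧ a < f ∧ 0 < b ∧ b < min (a * f - f ^ 2 / 4) (a * f / 4))) := by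
  refine ⟨fun x => by ring, ?_⟩
  have linear_coeff : f ^ 2 * a / 4 - f * b = f * (a * f / 4 - b) := by ring
  have const_coeff : f ^ 2 * b / 4 = f ^ 2 / 4 * b := by ring
  have hf2 : 0 < f ^ 2 / 4 := by positivity
  rw [linear_coeff, const_coeff, mul_pos_iff_of_pos_left hf, mul_pos_iff_of_pos_left hf2,
    lt_min_iff]
  constructor
  · rintro ⟨ha, hquad, hlin, hb⟩
    have hprod : 0 < f * (a - f / 4) := by linarith
    have hfa : 0 < a - f / 4 := (mul_pos_iff_of_pos_left hf).1 hprod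
    exact ⟨by linarith, by linarith, hb, by linarith, by linarith⟩
  · rintro ⟨-, ha, hb, hquad, hlin⟩
    exact ⟨by linarith, by linarith, by linarith, hb⟩
end

section
/- Let a, b, f, g be real numbers with 0 < f ≤ b < a < 1 and g ≥ 1 + a. Then ∫_{−1}^{g} (t + 1)(t + a)(t + b)(t − f)(t − g) dt < 0. -/
/-- Closed form of the integral of a monic quintic between two of its roots, `0` and `L`. -/
lemma integral_quintic_between_roots (A B F L : ℝ) :
    ∫ s in (0 : ℝ)..L, s * (s - A) * (s - B) * (s - F) * (s - L) =
      -(L ^ 3 / 60) * (2 * L ^ 3 - 3 * (A + B + F) * L ^ 2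
        + 5 * (A * B + A * F + B * F) * L - 10 * (A * B * F)) := by
  have expand : ∀ s : ℝ, s * (s - A) * (s - B) * (s - F) * (s - L) =
      s ^ 5 - (A + B + F + L) * s ^ 4 + (A * B + A * F + B * F + (A + B + F) * L) * s ^ 3
        - (A * B * F + (A * B + A * F + B * F) * L) * s ^ 2 + A * B * F * L * s ^ 1 := by
    intro s
    ring
  simp_rw [expand]
  rw [intervalIntegral.integral_add, intervalIntegral.integral_sub,
    intervalIntegral.integral_add, intervalIntegral.integral_sub]
  · simp only [intervalIntegral.integral_const_mul, integral_pow]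
    norm_num
    ring
  all_goals exact Continuous.intervalIntegrable (by fun_prop) _ _

/-- Positivity of the cubic factor, with the parameters written as `b = f + v`, `a = f + v + u`,
`g = 1 + a + x`. -/
lemma quintic_cubic_factor_pos {f v u x : ℝ} (hf : 0 < f) (hf1 : f < 1) (hv : 0 ≤ v)
    (hu : 0 ≤ u) (hx : 0 ≤ x) :
    0 < 3*x + 3*x^2 + 2*x^3 + 5*u + 8*u*x + 9*u*x^2 + 5*u^2 + 12*u^2*x + 5*u^3 + 7*v
      + 10*v*x + 12*v*x^2 + 12*v*u + 35*v*u*x + 23*v*u^2 + 7*v^2 + 23*v^2*x + 31*v^2*u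
      + 13*v^3 + 5*f + 8*f*x + 9*f*x^2 + 10*f*u + 24*f*u*x + 15*f*u^2 + 12*f*v + 30*f*v*x
      + 31*f*v*u + 16*f*v^2 + 5*f^2 + 7*f^2*x - 7*f^2*v - 10*f^3 := by
  have h1f : 0 < 1 - f := sub_pos.mpr hf1
  have key : 0 < 3*x + 3*x^2 + 2*x^3 + 5*u + 8*u*x + 9*u*x^2 + 5*u^2 + 12*u^2*x + 5*u^3
      + 7*v + 10*v*x + 12*v*x^2 + 12*v*u + 35*v*u*x + 23*v*u^2 + 7*v^2 + 23*v^2*x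
      + 31*v^2*u + 13*v^3 + 8*f*x + 9*f*x^2 + 10*f*u + 24*f*u*x + 15*f*u^2 + 5*f*v
      + 30*f*v*x + 31*f*v*u + 16*f*v^2 + 7*f^2*x + 7*f*v*(1 - f)
      + 5*f*(1 - f)*(1 + 2*f) := by positivity
  linarith [key]

/-- For `0 < f ≤ b < a < 1` and `g ≥ 1 + a`, the primitive
`M(x) = ∫_{−1}^x (t+1)(t+a)(t+b)(t−f)(t−g) dt` satisfies `M(g) < 0`. -/
theorem stmt_14 (a b f g : ℝ) (hf : 0 < f) (hfb : f ≤ b) (hba : b < a) (ha : a < 1)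
    (hg : 1 + a ≤ g) :
    (∫ t in (-1 : ℝ)..g, (t + 1) * (t + a) * (t + b) * (t - f) * (t - g)) < 0 := by
  have shift : (∫ t in (-1 : ℝ)..g, (t + 1) * (t + a) * (t + b) * (t - f) * (t - g)) =
      ∫ s in (0 : ℝ)..(g + 1),
        s * (s - (1 - a)) * (s - (1 - b)) * (s - (1 + f)) * (s - (g + 1)) := by
    have h := intervalIntegral.integral_comp_add_right (a := -1) (b := g)
      (fun s : ℝ => s * (s - (1 - a)) * (s - (1 - b)) * (s - (1 + f)) * (s - (g + 1))) 1
    rw [neg_add_cancel] at h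
    rw [← h]
    congr 1
    ext t
    ring
  rw [shift, integral_quintic_between_roots]
  have hL : 0 < g + 1 := by linarith
  have hpos := quintic_cubic_factor_pos hf (by linarith) (sub_nonneg.mpr hfb)
    (sub_nonneg.mpr hba.le) (sub_nonneg.mpr hg)
  refine mul_neg_of_neg_of_pos (neg_neg_of_pos (by positivity)) ?_
  linarith [hpos]
end

section
/- Let a, b, f, g be real numbers with 0 < f ≤ b < a < 1 and g ≥ 1 + a. Then ∫_{−b}^{g} (t + 1)(t + a)(t + b)(t − f)(t − g) dt < 0. -/
/-- The integral over `[0, L]` of a quintic vanishing at both endpoints, in closed form. -/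
theorem integral_quintic_zero_endpoints (p q r L : ℝ) :
    ∫ s in (0 : ℝ)..L, (s + q) * (s + p) * s * (s - r) * (s - L) =
      -(L ^ 3 / 60) * (2 * L ^ 3 + 3 * (p + q - r) * L ^ 2 + 5 * (p * q - r * (p + q)) * L
        - 10 * r * (p * q)) := by
  have hderiv : ∀ s ∈ Set.uIcc (0 : ℝ) L, HasDerivAt
      (fun s : ℝ => s ^ 6 * (1 / 6) + s ^ 5 * ((p + q - r - L) / 5)
        + s ^ 4 * ((p * q - r * (p + q) - L * (p + q - r)) / 4)
        + s ^ 3 * ((-(r * (p * q)) - L * (p * q - r * (p + q))) / 3)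
        + s ^ 2 * (L * (r * (p * q)) / 2))
      ((s + q) * (s + p) * s * (s - r) * (s - L)) s := by
    intro s _
    refine ((((((hasDerivAt_pow 6 s).mul_const _).add ((hasDerivAt_pow 5 s).mul_const _)).add
      ((hasDerivAt_pow 4 s).mul_const _)).add ((hasDerivAt_pow 3 s).mul_const _)).add
      ((hasDerivAt_pow 2 s).mul_const _)).congr_deriv ?_
    norm_num
    ring
  rw [intervalIntegral.integral_eq_sub_of_hasDerivAt hderiv
    (Continuous.intervalIntegrable (by fun_prop) _ _)]
  ring

/-- The cubic factor of the closed form is positive for `L = 3 b + p + q + h`, `r = 2 b - e`. -/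
theorem cubic_factor_pos {b p q e h L r : ℝ} (hb : 0 < b) (hp : 0 < p) (hq : 0 < q)
    (he : 0 ≤ e) (hh : 0 ≤ h) (hL : L = 3 * b + p + q + h) (hr : r = 2 * b - e) :
    0 < 2 * L ^ 3 + 3 * (p + q - r) * L ^ 2 + 5 * (p * q - r * (p + q)) * L
      - 10 * r * (p * q) := by
  have hL0 : 0 < L := by rw [hL]; positivity
  have key : 2 * L ^ 3 + 3 * (p + q - r) * L ^ 2 + 5 * (p * q - r * (p + q)) * L
      - 10 * r * (p * q) =
      e * (3 * L ^ 2 + 5 * (p + q) * L + 10 * (p * q))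
      + 5 * ((p + q) * (3 * b ^ 2 + (p + q) ^ 2) + 3 * b * (p + q) ^ 2
        + b * (p ^ 2 + p * q + q ^ 2) + p * q * (p + q))
      + h * (18 * b ^ 2 + 32 * b * (p + q) + 12 * (p + q) ^ 2 + 5 * (p * q))
      + h ^ 2 * (12 * b + 9 * (p + q)) + 2 * h ^ 3 := by
    rw [hL, hr]
    ring
  rw [key]
  positivity


/-- For `0 < f ≤ b < a < 1` and `g ≥ 1 + a`, one has `M(g) < M(−b)` where
`M(x) = ∫_{−1}^x (t+1)(t+a)(t+b)(t−f)(t−g) dt`, i.e. the integral of the quintic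
from `−b` to `g` is negative. -/
theorem stmt_15 (a b f g : ℝ) (hf : 0 < f) (hfb : f ≤ b) (hba : b < a) (ha : a < 1)
    (hg : 1 + a ≤ g) :
    (∫ t in (-b : ℝ)..g, (t + 1) * (t + a) * (t + b) * (t - f) * (t - g)) < 0 := by
  have hshift : (∫ t in (-b : ℝ)..g, (t + 1) * (t + a) * (t + b) * (t - f) * (t - g)) =
      ∫ s in (0 : ℝ)..(g + b),
        (s + (1 - b)) * (s + (a - b)) * s * (s - (f + b)) * (s - (g + b)) := by
    have hsub := intervalIntegral.integral_comp_sub_right (a := 0) (b := g + b)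
      (fun t : ℝ => (t + 1) * (t + a) * (t + b) * (t - f) * (t - g)) b
    rw [zero_sub, add_sub_cancel_right] at hsub
    rw [← hsub]
    congr 1
    ext s
    ring
  rw [hshift, integral_quintic_zero_endpoints]
  have hpos := cubic_factor_pos (b := b) (p := a - b) (q := 1 - b) (e := b - f)
    (h := g - (1 + a)) (L := g + b) (r := f + b) (by linarith) (by linarith) (by linarith)
    (by linarith) (by linarith) (by ring) (by ring)
  have hL : 0 < g + b := by linarith
  rw [neg_mul, neg_lt_zero]
  positivity
end

section
/- Let a, b be real numbers with 0 < b < a < 1. Then the function g ↦ ∫_{−1}^{g} (t + 1)(t + a)(t + b)(t − b)(t − g) dt is strictly decreasing on the interval [1 + a, ∞). Equivalently, for every g ≥ 1 + a one has ∫_{−1}^{g} (t + 1)(t + a)(t² − b²) dt > 0. -/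
/-- Closed form of the integral of the quartic `(t + 1) (t + a) (t² - b²)` from `-1`. -/
lemma integral_quartic_eq (a b g : ℝ) :
    ∫ t in (-1 : ℝ)..g, (t + 1) * (t + a) * (t ^ 2 - b ^ 2) =
      (g ^ 5 / 5 + (1 + a) * g ^ 4 / 4 + (a - b ^ 2) * g ^ 3 / 3
        - (1 + a) * b ^ 2 * g ^ 2 / 2 - a * b ^ 2 * g)
      - (-1 / 5 + (1 + a) / 4 - (a - b ^ 2) / 3 - (1 + a) * b ^ 2 / 2 + a * b ^ 2) := by
  have hderiv : ∀ t ∈ Set.uIcc (-1 : ℝ) g,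
      HasDerivAt (fun t : ℝ => t ^ 5 / 5 + (1 + a) * t ^ 4 / 4 + (a - b ^ 2) * t ^ 3 / 3
        - (1 + a) * b ^ 2 * t ^ 2 / 2 - a * b ^ 2 * t)
        ((t + 1) * (t + a) * (t ^ 2 - b ^ 2)) t := by
    intro t _
    refine HasDerivAt.congr_deriv ((((((hasDerivAt_pow 5 t).div_const 5).add
      (((hasDerivAt_pow 4 t).const_mul (1 + a)).div_const 4)).add
      (((hasDerivAt_pow 3 t).const_mul (a - b ^ 2)).div_const 3)).sub
      (((hasDerivAt_pow 2 t).const_mul ((1 + a) * b ^ 2)).div_const 2)).sub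
      ((hasDerivAt_id t).const_mul (a * b ^ 2))) ?_
    norm_num
    ring
  rw [intervalIntegral.integral_eq_sub_of_hasDerivAt hderiv
    (Continuous.intervalIntegrable (by fun_prop) _ _)]
  ring

lemma integral_quartic_pos {a b g : ℝ} (hb : 0 < b) (hba : b < a) (ha : a < 1)
    (hg : 1 + a ≤ g) : 0 < ∫ t in (-1 : ℝ)..g, (t + 1) * (t + a) * (t ^ 2 - b ^ 2) := by
  rw [integral_quartic_eq]
  have ha0 : 0 < a := hb.trans hba
  obtain ⟨d, hd, rfl⟩ : ∃ d, 0 ≤ d ∧ g = 1 + a + d := ⟨g - (1 + a), by linarith, by ring⟩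
  have hsq : 0 ≤ a ^ 2 - b ^ 2 := by nlinarith
  -- The integral is affine in `b ^ 2` with negative slope, so `b = a` is the worst case.
  have hslope : 0 ≤ (a ^ 2 - b ^ 2) *
      ((2 + a + d) ^ 2 * ((2 + a + d) / 3 - (1 - a) / 2)) :=
    mul_nonneg hsq (mul_nonneg (sq_nonneg _) (by linarith))
  -- Taylor expansion of the case `b = a` in `d = g - (1 + a)`.
  have hconst : 0 < 2 / 5 + 8 / 3 * a + 29 / 6 * a ^ 2 + 3 / 2 * a ^ 3
      - 11 / 12 * a ^ 4 - 23 / 60 * a ^ 5 := by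
    have h4 : a ^ 4 ≤ a ^ 3 := pow_le_pow_of_le_one ha0.le ha.le (by norm_num)
    have h5 : a ^ 5 ≤ a ^ 3 := pow_le_pow_of_le_one ha0.le ha.le (by norm_num)
    have h2 : 0 < a ^ 2 := by positivity
    have h3 : 0 < a ^ 3 := by positivity
    linarith
  have htail : 0 ≤ (2 + a) * (1 + 2 * a) ^ 2 * d
      + (2 * (2 + a) * (1 + 2 * a) + (3 + a) * (1 + 2 * a) ^ 2) * d ^ 2 / 2
      + ((2 + a) + 2 * (1 + 2 * a) * (3 + a) + (1 + 2 * a) ^ 2) * d ^ 3 / 3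
      + ((3 + a) + 2 * (1 + 2 * a)) * d ^ 4 / 4 + d ^ 5 / 5 := by
    positivity
  linear_combination hslope + hconst + htail

theorem hasDerivAt_integral_mul_sub {p : ℝ → ℝ} (hp : Continuous p) (c g : ℝ) :
    HasDerivAt (fun x : ℝ => ∫ t in c..x, p t * (t - x)) (-∫ t in c..g, p t) g := by
  have hsplit : (fun x : ℝ => ∫ t in c..x, p t * (t - x)) =
      fun x => (∫ t in c..x, p t * t) - (∫ t in c..x, p t) * x := by
    funext x
    rw [← intervalIntegral.integral_mul_const, ← intervalIntegral.integral_sub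
      (Continuous.intervalIntegrable (by fun_prop) _ _)
      (Continuous.intervalIntegrable (by fun_prop) _ _)]
    simp only [mul_sub]
  have hpt : Continuous fun t => p t * t := by fun_prop
  rw [hsplit]
  refine HasDerivAt.congr_deriv ((hpt.integral_hasStrictDerivAt c g).hasDerivAt.sub
    ((hp.integral_hasStrictDerivAt c g).hasDerivAt.mul (hasDerivAt_id g))) ?_
  simp

/-- For `0 < b < a < 1`, the function `g ↦ ∫_{−1}^g (t+1)(t+a)(t+b)(t−b)(t−g) dt`
is strictly decreasing on `[1 + a, ∞)`; equivalently, for every `g ≥ 1 + a` one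
has `∫_{−1}^g (t+1)(t+a)(t² − b²) dt > 0`. -/
theorem stmt_16 (a b : ℝ) (hb : 0 < b) (hba : b < a) (ha : a < 1) :
    StrictAntiOn
      (fun g : ℝ => ∫ t in (-1 : ℝ)..g, (t + 1) * (t + a) * (t + b) * (t - b) * (t - g))
      (Set.Ici (1 + a)) ∧
    ∀ g : ℝ, 1 + a ≤ g →
      0 < ∫ t in (-1 : ℝ)..g, (t + 1) * (t + a) * (t ^ 2 - b ^ 2) := by
  refine ⟨?_, fun g hg => integral_quartic_pos hb hba ha hg⟩
  have hfactor : ∀ t : ℝ,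
      (t + 1) * (t + a) * (t + b) * (t - b) = (t + 1) * (t + a) * (t ^ 2 - b ^ 2) :=
    fun t => by ring
  simp only [hfactor]
  have hderiv := hasDerivAt_integral_mul_sub
    (p := fun t : ℝ => (t + 1) * (t + a) * (t ^ 2 - b ^ 2)) (by fun_prop) (-1)
  refine strictAntiOn_of_deriv_neg (convex_Ici _)
    (fun g _ => (hderiv g).continuousAt.continuousWithinAt) fun g hg => ?_
  rw [interior_Ici] at hg
  rw [(hderiv g).deriv]
  exact neg_neg_of_pos (integral_quartic_pos hb hba ha (le_of_lt hg))
end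

section
/- For all real numbers a and b, ∫_{−1}^{1+a} (t + 1)(t + a)(t + b)(t − b)(t − (1 + a)) dt = −(2 + a)³ · a · (a² − 3b² + a + 1)/12. In particular, if 0 < b < a < 1 then this integral is strictly negative. -/
/-- Evaluation of `M(1 + a)` with `f = b`, `g = 1 + a`:
`∫_{−1}^{1+a} (t+1)(t+a)(t+b)(t−b)(t−(1+a)) dt = −(2+a)³ a (a² − 3b² + a + 1)/12`,
which is negative when `0 < b < a < 1`. -/
theorem stmt_17 (a b : ℝ) :
    (∫ t in (-1 : ℝ)..(1 + a),
        (t + 1) * (t + a) * (t + b) * (t - b) * (t - (1 + a))) =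
      -(2 + a) ^ 3 * a * (a ^ 2 - 3 * b ^ 2 + a + 1) / 12 ∧
    (0 < b → b < a → a < 1 →
      (∫ t in (-1 : ℝ)..(1 + a),
          (t + 1) * (t + a) * (t + b) * (t - b) * (t - (1 + a))) < 0) := by
  have integral_eq : (∫ t in (-1 : ℝ)..(1 + a),
      (t + 1) * (t + a) * (t + b) * (t - b) * (t - (1 + a))) =
      -(2 + a) ^ 3 * a * (a ^ 2 - 3 * b ^ 2 + a + 1) / 12 := by
    have hderiv : ∀ t ∈ Set.uIcc (-1 : ℝ) (1 + a),
        HasDerivAt (fun t : ℝ => t ^ 6 / 6 - (1 + a + a ^ 2 + b ^ 2) * (t ^ 4 / 4)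
          - a * (1 + a) * (t ^ 3 / 3) + (1 + a + a ^ 2) * b ^ 2 * (t ^ 2 / 2)
          + a * (1 + a) * b ^ 2 * t)
        ((t + 1) * (t + a) * (t + b) * (t - b) * (t - (1 + a))) t := by
      intro t _
      refine HasDerivAt.congr_deriv ((((((hasDerivAt_pow 6 t).div_const 6).sub
        (((hasDerivAt_pow 4 t).div_const 4).const_mul (1 + a + a ^ 2 + b ^ 2))).sub
        (((hasDerivAt_pow 3 t).div_const 3).const_mul (a * (1 + a)))).add
        (((hasDerivAt_pow 2 t).div_const 2).const_mul ((1 + a + a ^ 2) * b ^ 2))).add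
        ((hasDerivAt_id t).const_mul (a * (1 + a) * b ^ 2))) ?_
      push_cast
      ring
    rw [intervalIntegral.integral_eq_sub_of_hasDerivAt hderiv
      (Continuous.intervalIntegrable (by fun_prop) _ _)]
    ring
  refine ⟨integral_eq, fun hb hba ha => ?_⟩
  have hpos : 0 < a ^ 2 - 3 * b ^ 2 + a + 1 := by nlinarith
  have ha0 : 0 < a := hb.trans hba
  have hprod : 0 < (2 + a) ^ 3 * a * (a ^ 2 - 3 * b ^ 2 + a + 1) := by positivity
  rw [integral_eq]
  linarith
end
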